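/- Let m ≥ 1, let α₁,…,α_m be real numbers with 0 < α_i < Q for each i, and let α = α₁+⋯+α_m. Then the operator norm of the m-linear Hilbert operator P_m^{h*} from H^∞_{α₁}(ℍⁿ)×⋯×H^∞_{α_m}(ℍⁿ) to H^∞_α(ℍⁿ) (the least constant C with ‖P_m^{h*}(f₁,…,f_m)‖_{H^∞_α} ≤ C ∏_{i=1}^m ‖f_i‖_{H^∞_{α_i}} for all f_i ∈ H^∞_{α_i}(ℍⁿ)) equals exactly Ω_Q^m · (∏_{i=1}^m Γ(1 - α_i/Q)) · Γ(α/Q) / Γ(m). -/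

import Mathlib

open MeasureTheory ENNReal

/-- The Korányi (homogeneous) norm on the Heisenberg group `ℍⁿ ≃ ℝ^{2n+1}`. -/
noncomputable def hnorm (n : ℕ) (x : Fin (2*n+1) → ℝ) : ℝ :=
  ((∑ i : Fin (2*n+1), if (i : ℕ) < 2*n then (x i)^2 else 0)^2
    + (x (Fin.last (2*n)))^2) ^ ((1:ℝ)/4)

/-- The Heisenberg dilations `δ_r`. -/
noncomputable def dil (n : ℕ) (r : ℝ) (x : Fin (2*n+1) → ℝ) : Fin (2*n+1) → ℝ :=
  fun i => if (i : ℕ) < 2*n then r * x i else r^2 * x i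

/-- The norm of the weighted-type space `H^∞_α(ℍⁿ)`:
`‖f‖ = ess sup_x |x|_h^α |f x|`. -/
noncomputable def wnorm (n : ℕ) (α : ℝ) (f : (Fin (2*n+1) → ℝ) → ℝ) : ℝ≥0∞ :=
  essSup (fun x => ENNReal.ofReal (hnorm n x ^ α * |f x|)) volume

/-- `Ω_Q`: the volume of the Korányi unit ball. -/
noncomputable def ΩQ (n : ℕ) : ℝ :=
  (volume {x : Fin (2*n+1) → ℝ | hnorm n x < 1}).toReal


open Set in
lemma lint_gamma {a r : ℝ} (ha : 0 < a) (hr : 0 < r) :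
    ∫⁻ t in Ioi (0:ℝ), ENNReal.ofReal (t ^ (a - 1) * Real.exp (-(r * t)))
      = ENNReal.ofReal (r ^ (-a) * Real.Gamma a) := by
  have key := Real.integral_rpow_mul_exp_neg_mul_Ioi ha hr
  have hG := Real.Gamma_pos_of_pos ha
  rw [one_div, Real.inv_rpow hr.le, ← Real.rpow_neg hr.le] at key
  have hint : Integrable (fun t : ℝ => t ^ (a - 1) * Real.exp (-(r * t)))
      (volume.restrict (Ioi 0)) :=
    .of_integral_ne_zero (by rw [key]; positivity)
  rw [← key, ofReal_integral_eq_lintegral_ofReal hint]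
  filter_upwards [ae_restrict_mem measurableSet_Ioi] with t ht
  have : (0:ℝ) < t := ht
  simp only [Pi.zero_apply]
  positivity

lemma lint_pi_prod {E : Type*} [MeasureSpace E] [SigmaFinite (volume : Measure E)] :
    ∀ (m : ℕ) (f : Fin m → E → ℝ≥0∞), (∀ i, Measurable (f i)) →
    ∫⁻ y : Fin m → E, ∏ i, f i (y i) = ∏ i, ∫⁻ y, f i y := by
  intro m
  induction m with
  | zero => intro f _; simp [volume_pi]
  | succ m ih =>
    intro f hf
    have := (volume_preserving_piFinSuccAbove (fun _ : Fin (m+1) => E) 0).symm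
    rw [← this.lintegral_comp_emb (MeasurableEquiv.measurableEmbedding _)]
    simp only [Fin.prod_univ_succ, MeasurableEquiv.piFinSuccAbove_symm_apply]
    rw [← ih (fun i => f i.succ) (fun i => hf _)]
    have h2 := lintegral_prod_mul (μ := (volume : Measure E))
      (ν := (volume : Measure (Fin m → E))) (f := f 0)
      (g := fun y => ∏ i : Fin m, f i.succ (y i)) (hf 0).aemeasurable
      (Finset.measurable_prod _ fun i _ => (hf i.succ).comp (measurable_pi_apply i)).aemeasurable
    rw [← h2]
    rfl

lemma hnorm_nonneg (n : ℕ) (x : Fin (2*n+1) → ℝ) : 0 ≤ hnorm n x := by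
  unfold hnorm; positivity

lemma hnorm_meas (n : ℕ) : Measurable (hnorm n) := by
  unfold hnorm
  refine Measurable.pow_const ?_ _
  refine Measurable.add (Measurable.pow_const (Finset.measurable_sum _ fun i _ => ?_) _)
    (by fun_prop)
  split_ifs
  · fun_prop
  · exact measurable_const

lemma hnorm_dil (n : ℕ) {r : ℝ} (hr : 0 < r) (x : Fin (2*n+1) → ℝ) :
    hnorm n (dil n r x) = r * hnorm n x := by
  unfold hnorm dil
  have h1 : (∑ i : Fin (2*n+1), if (i : ℕ) < 2*n then
      ((if (i : ℕ) < 2*n then r * x i else r^2 * x i))^2 else 0)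
      = r^2 * ∑ i : Fin (2*n+1), if (i : ℕ) < 2*n then (x i)^2 else 0 := by
    rw [Finset.mul_sum]
    refine Finset.sum_congr rfl fun i _ => ?_
    split_ifs <;> ring
  rw [h1]
  simp only [Fin.val_last, lt_irrefl, if_false]
  rw [show ∀ S z : ℝ, (r^2 * S)^2 + (r^2 * z)^2 = r^4 * (S^2 + z^2) by intros; ring,
    Real.mul_rpow (by positivity) (by positivity)]
  congr 1
  rw [← Real.rpow_natCast, ← Real.rpow_mul hr.le]
  norm_num

lemma vol_ball_lt_top (n : ℕ) : volume {x : Fin (2*n+1) → ℝ | hnorm n x < 1} < ⊤ := by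
  refine lt_of_le_of_lt (measure_mono (t := Set.Icc (fun _ => -1) (fun _ => 1)) ?_)
    (isCompact_Icc.measure_lt_top)
  intro x hx
  have hx : hnorm n x < 1 := hx
  unfold hnorm at hx
  set S := ∑ i : Fin (2*n+1), if (i : ℕ) < 2*n then (x i)^2 else 0 with hS
  have hS0 : 0 ≤ S := Finset.sum_nonneg fun i _ => by split_ifs <;> positivity
  have h1 : S^2 + (x (Fin.last (2*n)))^2 < 1 := by
    by_contra h
    push Not at h
    exact absurd hx (not_lt.mpr (Real.one_le_rpow h (by norm_num)))
  have h2 : ∀ i, |x i| ≤ 1 := by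
    intro i
    rw [← sq_le_one_iff_abs_le_one]
    by_cases hi : (i : ℕ) < 2*n
    · have h3 : (x i)^2 ≤ S := by
        have := Finset.single_le_sum (f := fun i : Fin (2*n+1) =>
          if (i : ℕ) < 2*n then (x i)^2 else 0)
          (fun i _ => by split_ifs <;> positivity) (Finset.mem_univ i)
        simpa [hi] using this
      nlinarith [sq_nonneg (x (Fin.last (2*n)))]
    · have : i = Fin.last (2*n) := by
        ext; simp; omega
      rw [this]; nlinarith
  exact ⟨fun i => (abs_le.mp (h2 i)).1, fun i => (abs_le.mp (h2 i)).2⟩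

lemma vol_ball (n : ℕ) {r : ℝ} (hr : 0 < r) :
    volume {x : Fin (2*n+1) → ℝ | hnorm n x < r}
      = ENNReal.ofReal (r ^ (2*n+2)) * ENNReal.ofReal (ΩQ n) := by
  set D : Fin (2*n+1) → ℝ := fun i => if (i : ℕ) < 2*n then r⁻¹ else (r⁻¹)^2 with hD
  have hdet : (Matrix.diagonal D).det = (r ^ (2*n+2))⁻¹ := by
    rw [Matrix.det_diagonal, Fin.prod_univ_castSucc]
    simp [hD]
    ring
  have hpos : 0 < r ^ (2*n+2) := by positivity
  have h := Real.smul_map_diagonal_volume_pi (D := D) (by rw [hdet]; positivity)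
  rw [hdet, abs_of_pos (by positivity)] at h
  have hmeas : ∀ s : ℝ, MeasurableSet {x : Fin (2*n+1) → ℝ | hnorm n x < s} := fun s =>
    measurableSet_lt (hnorm_meas n) measurable_const
  have h2 := congrArg (fun μ => μ {x : Fin (2*n+1) → ℝ | hnorm n x < 1}) h
  simp only [Measure.smul_apply, smul_eq_mul] at h2
  rw [Measure.map_apply (LinearMap.continuous_on_pi _).measurable (hmeas 1)] at h2
  have h3 : (Matrix.toLin' (Matrix.diagonal D)) ⁻¹' {x : Fin (2*n+1) → ℝ | hnorm n x < 1}
      = {x : Fin (2*n+1) → ℝ | hnorm n x < r} := by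
    ext x
    have : (Matrix.toLin' (Matrix.diagonal D)) x = dil n r⁻¹ x := by
      ext i
      simp only [Matrix.toLin'_apply, Matrix.mulVec_diagonal, hD, dil]
      split_ifs <;> rfl
    simp only [Set.mem_preimage, Set.mem_ofPred_eq, this, hnorm_dil n (inv_pos.mpr hr)]
    rw [inv_mul_lt_iff₀ hr, mul_one]
  rw [h3] at h2
  rw [ΩQ, ENNReal.ofReal_toReal (vol_ball_lt_top n).ne, ← h2, ← mul_assoc,
    ← ENNReal.ofReal_mul hpos.le, mul_inv_cancel₀ hpos.ne']
  simp

open Set in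
lemma map_hnorm (n : ℕ) (Q : ℝ) (hQ : Q = 2*n+2) :
    Measure.map (fun x => hnorm n x ^ Q) volume
      = ENNReal.ofReal (ΩQ n) • (volume.restrict (Ioi (0:ℝ))) := by
  have hQ0 : 0 < Q := by rw [hQ]; positivity
  have hm : Measurable (fun x => hnorm n x ^ Q) := (hnorm_meas n).pow_const _
  have hIio : ∀ b : ℝ, Measure.map (fun x => hnorm n x ^ Q) volume (Iio b)
      = ENNReal.ofReal (ΩQ n) * ENNReal.ofReal b := by
    intro b
    rw [Measure.map_apply hm measurableSet_Iio]
    rcases le_or_gt b 0 with hb | hb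
    · rw [ENNReal.ofReal_of_nonpos hb, mul_zero]
      convert measure_empty (μ := volume)
      ext x
      simp only [mem_preimage, mem_Iio, mem_empty_iff_false, iff_false, not_lt]
      exact hb.trans (Real.rpow_nonneg (hnorm_nonneg n x) _)
    · have : (fun x => hnorm n x ^ Q) ⁻¹' Iio b = {x | hnorm n x < b ^ (Q⁻¹)} := by
        ext x
        simp only [mem_preimage, mem_Iio, mem_ofPred_eq]
        rw [Real.lt_rpow_inv_iff_of_pos (hnorm_nonneg n x) hb.le hQ0]
      rw [this, vol_ball n (by positivity), mul_comm]
      congr 2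
      rw [← Real.rpow_natCast, ← Real.rpow_mul hb.le]
      push_cast
      rw [← hQ, inv_mul_cancel₀ hQ0.ne', Real.rpow_one]
  have hIco : ∀ a b : ℝ, a < b → Measure.map (fun x => hnorm n x ^ Q) volume (Ico a b)
      = ENNReal.ofReal (ΩQ n) * ENNReal.ofReal b - ENNReal.ofReal (ΩQ n) * ENNReal.ofReal a := by
    intro a b hab
    rw [← Iio_sdiff_Iio, measure_sdiff (Iio_subset_Iio hab.le) measurableSet_Iio.nullMeasurableSet,
      hIio, hIio]
    rw [hIio]
    exact ENNReal.mul_ne_top ENNReal.ofReal_ne_top ENNReal.ofReal_ne_top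
  refine Measure.ext_of_Ico' _ _ (fun a b hab => ?_) (fun a b hab => ?_)
  · rw [hIco a b hab]
    exact (tsub_le_self.trans_lt (ENNReal.mul_lt_top ENNReal.ofReal_lt_top ENNReal.ofReal_lt_top)).ne
  · rw [hIco a b hab, ← ENNReal.mul_sub (fun _ _ => ENNReal.ofReal_ne_top),
      Measure.smul_apply, smul_eq_mul, Measure.restrict_apply measurableSet_Ico]
    congr 1
    have h1 : volume (Ico a b ∩ Ioi (0:ℝ)) = volume (Ico a b ∩ Ici (0:ℝ)) :=
      measure_congr ((Filter.EventuallyEq.refl _ _).inter Ioi_ae_eq_Ici)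
    have h2 : Ico a b ∩ Ici (0:ℝ) = Ico (max a 0) b := by
      ext; simp [and_assoc, and_comm, and_left_comm]
    rw [h1, h2, Real.volume_Ico]
    rcases le_or_gt a 0 with ha | ha
    · rw [max_eq_right ha, ENNReal.ofReal_of_nonpos ha]; simp
    · rw [max_eq_left ha.le, ENNReal.ofReal_sub _ ha.le]

lemma hnorm_ae_pos (n : ℕ) : ∀ᵐ x : Fin (2*n+1) → ℝ, 0 < hnorm n x := by
  have h := map_hnorm n _ rfl
  have hm : Measurable (fun x => hnorm n x ^ (2*n+2:ℝ)) := (hnorm_meas n).pow_const _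
  have h2 : ∀ᵐ u ∂(Measure.map (fun x => hnorm n x ^ (2*n+2:ℝ)) volume), (0:ℝ) < u := by
    rw [h]
    exact Measure.ae_smul_measure (ae_restrict_mem measurableSet_Ioi) _
  filter_upwards [ae_of_ae_map hm.aemeasurable h2] with x hx
  refine lt_of_le_of_ne (hnorm_nonneg n x) fun h0 => ?_
  rw [← h0, Real.zero_rpow (by positivity)] at hx
  exact lt_irrefl _ hx

lemma inner_int (n : ℕ) (Q : ℝ) (hQ : Q = 2*n+2) {a t : ℝ} (ha : a < Q) (ht : 0 < t) :
    ∫⁻ y, ENNReal.ofReal (hnorm n y ^ (-a) * Real.exp (-(t * hnorm n y ^ Q)))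
      = ENNReal.ofReal (ΩQ n * Real.Gamma (1 - a / Q) * t ^ (a / Q - 1)) := by
  have hQ0 : 0 < Q := by rw [hQ]; positivity
  have hm : Measurable (fun x => hnorm n x ^ Q) := (hnorm_meas n).pow_const _
  have hΩ : 0 ≤ ΩQ n := ENNReal.toReal_nonneg
  have h1 : ∀ y, ENNReal.ofReal (hnorm n y ^ (-a) * Real.exp (-(t * hnorm n y ^ Q)))
      = (fun u : ℝ => ENNReal.ofReal (u ^ ((1 - a / Q) - 1) * Real.exp (-(t * u))))
        (hnorm n y ^ Q) := by
    intro y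
    dsimp only
    rw [← Real.rpow_mul (hnorm_nonneg n y)]
    congr 3
    field_simp
    ring
  simp_rw [h1]
  rw [← lintegral_map (f := fun u : ℝ => ENNReal.ofReal (u ^ ((1 - a / Q) - 1) * Real.exp (-(t * u))))
    (by fun_prop) hm, map_hnorm n Q hQ, lintegral_smul_measure,
    lint_gamma (by rw [sub_pos, div_lt_one hQ0]; exact ha) ht, smul_eq_mul,
    ← ENNReal.ofReal_mul hΩ]
  congr 1
  rw [neg_sub]; ring

lemma key_int (n : ℕ) (m : ℕ) (hm : 1 ≤ m) (Q : ℝ) (hQ : Q = 2*n+2)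
    (α : Fin m → ℝ) (hα : ∀ i, 0 < α i ∧ α i < Q) {r : ℝ} (hr : 0 < r) :
    ∫⁻ y : Fin m → Fin (2*n+1) → ℝ, ENNReal.ofReal ((∏ i, hnorm n (y i) ^ (-α i))
        / (r + ∑ i, hnorm n (y i) ^ Q) ^ m)
      = ENNReal.ofReal ((ΩQ n ^ m * (∏ i, Real.Gamma (1 - α i / Q)) *
        Real.Gamma ((∑ i, α i) / Q) / Real.Gamma m) * r ^ (-((∑ i, α i) / Q))) := by
  have hQ0 : 0 < Q := by rw [hQ]; positivity
  have hm0 : (0:ℝ) < m := by exact_mod_cast hm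
  have hG : 0 < Real.Gamma m := Real.Gamma_pos_of_pos hm0
  have hΩ : 0 ≤ ΩQ n := ENNReal.toReal_nonneg
  have hmeas := hnorm_meas n
  have hGi : ∀ i, 0 < Real.Gamma (1 - α i / Q) := fun i =>
    Real.Gamma_pos_of_pos (by rw [sub_pos, div_lt_one hQ0]; exact (hα i).2)
  have hsum : 0 < ∑ i, α i :=
    Finset.sum_pos (fun i _ => (hα i).1) ⟨⟨0, hm⟩, Finset.mem_univ _⟩
  set K : (Fin m → Fin (2*n+1) → ℝ) → ℝ → ℝ≥0∞ := fun y t =>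
    ENNReal.ofReal (Real.Gamma m)⁻¹ * (ENNReal.ofReal (t ^ ((m:ℝ) - 1) * Real.exp (-(r * t))) *
      ∏ i, ENNReal.ofReal (hnorm n (y i) ^ (-α i) * Real.exp (-(t * hnorm n (y i) ^ Q)))) with hK
  have hpt : ∀ y : Fin m → Fin (2*n+1) → ℝ, ENNReal.ofReal ((∏ i, hnorm n (y i) ^ (-α i))
        / (r + ∑ i, hnorm n (y i) ^ Q) ^ m) = ∫⁻ t in Set.Ioi (0:ℝ), K y t := by
    intro y
    set s := r + ∑ i, hnorm n (y i) ^ Q with hs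
    have hs0 : 0 < s := by
      have : 0 ≤ ∑ i, hnorm n (y i) ^ Q :=
        Finset.sum_nonneg fun i _ => Real.rpow_nonneg (hnorm_nonneg n _) _
      linarith
    set P := ∏ i, hnorm n (y i) ^ (-α i) with hP
    have hP0 : 0 ≤ P := Finset.prod_nonneg fun i _ => Real.rpow_nonneg (hnorm_nonneg n _) _
    have h1 : P / s ^ m = ((Real.Gamma m)⁻¹ * P) * (s ^ (-(m:ℝ)) * Real.Gamma m) := by
      rw [Real.rpow_neg hs0.le, Real.rpow_natCast]
      field_simp
    rw [h1, ENNReal.ofReal_mul (by positivity), ← lint_gamma hm0 hs0,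
      ← lintegral_const_mul _ (by fun_prop)]
    refine setLIntegral_congr_fun measurableSet_Ioi fun t ht => ?_
    have ht : (0:ℝ) < t := ht
    simp only [hK]
    rw [← ENNReal.ofReal_prod_of_nonneg (fun i _ => mul_nonneg
        (Real.rpow_nonneg (hnorm_nonneg n _) _) (Real.exp_pos _).le),
      ← ENNReal.ofReal_mul (by positivity), ← ENNReal.ofReal_mul (by positivity),
      ← ENNReal.ofReal_mul (by positivity), Finset.prod_mul_distrib, ← Real.exp_sum, ← hP]
    congr 1
    have h2 : Real.exp (-(s * t)) = Real.exp (-(r * t)) *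
        Real.exp (∑ i, -(t * hnorm n (y i) ^ Q)) := by
      rw [← Real.exp_add, Finset.sum_neg_distrib, ← Finset.mul_sum, hs]
      congr 1; ring
    rw [h2]; ring
  simp_rw [hpt]
  have hKm : Measurable (Function.uncurry K) := by
    have hc : ∀ i : Fin m, Measurable (fun p : (Fin m → Fin (2*n+1) → ℝ) × ℝ =>
        hnorm n (p.1 i)) := fun i => hmeas.comp ((measurable_pi_apply i).comp measurable_fst)
    simp only [hK, Function.uncurry_def]
    refine Measurable.const_mul (Measurable.mul (by fun_prop)
      (Finset.measurable_prod _ fun i _ => ?_)) _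
    exact (((hc i).pow_const _).mul
      (Real.measurable_exp.comp (measurable_snd.mul ((hc i).pow_const _)).neg)).ennreal_ofReal
  rw [lintegral_lintegral_swap hKm.aemeasurable]
  have hin : ∀ t ∈ Set.Ioi (0:ℝ), ∫⁻ y, K y t
      = ENNReal.ofReal ((Real.Gamma m)⁻¹ * (ΩQ n ^ m * ∏ i, Real.Gamma (1 - α i / Q))) *
        ENNReal.ofReal (t ^ ((∑ i, α i) / Q - 1) * Real.exp (-(r * t))) := by
    intro t ht
    have ht : (0:ℝ) < t := ht
    have hmf : ∀ i, Measurable (fun y => ENNReal.ofReal (hnorm n y ^ (-α i) *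
        Real.exp (-(t * hnorm n y ^ Q)))) := fun i =>
      ((hmeas.pow_const _).mul
        (Real.measurable_exp.comp ((hmeas.pow_const _).const_mul t).neg)).ennreal_ofReal
    have hmp : Measurable (fun y : Fin m → Fin (2*n+1) → ℝ => ∏ i, ENNReal.ofReal
        (hnorm n (y i) ^ (-α i) * Real.exp (-(t * hnorm n (y i) ^ Q)))) :=
      Finset.measurable_prod _ fun i _ => (hmf i).comp (measurable_pi_apply i)
    simp only [hK]
    rw [lintegral_const_mul _ (hmp.const_mul _), lintegral_const_mul _ hmp,
      lint_pi_prod m _ hmf]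
    simp_rw [fun i => inner_int n Q hQ (hα i).2 ht]
    have hnn : ∀ i, 0 ≤ ΩQ n * Real.Gamma (1 - α i / Q) * t ^ (α i / Q - 1) := fun i =>
      mul_nonneg (mul_nonneg hΩ (hGi i).le) (by positivity)
    have hpg : 0 ≤ ∏ i, Real.Gamma (1 - α i / Q) := Finset.prod_nonneg fun i _ => (hGi i).le
    rw [← ENNReal.ofReal_prod_of_nonneg (fun i _ => hnn i),
      ← ENNReal.ofReal_mul (by positivity), ← ENNReal.ofReal_mul (by positivity),
      ← ENNReal.ofReal_mul (by positivity)]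
    congr 1
    rw [Finset.prod_mul_distrib, Finset.prod_mul_distrib, Finset.prod_const, Finset.card_univ,
      Fintype.card_fin, ← Real.rpow_sum_of_pos ht, Finset.sum_sub_distrib, ← Finset.sum_div]
    have : t ^ ((∑ i, α i) / Q - 1) = t ^ ((m:ℝ) - 1) * t ^ ((∑ i, α i) / Q - ∑ i : Fin m, (1:ℝ)) := by
      rw [← Real.rpow_add ht]; congr 1; simp
    rw [this]; ring
  rw [setLIntegral_congr_fun measurableSet_Ioi hin, lintegral_const_mul _ (by fun_prop),
    lint_gamma (by positivity) hr, ← ENNReal.ofReal_mul (mul_nonneg (by positivity)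
      (mul_nonneg (by positivity) (Finset.prod_nonneg fun i _ => (hGi i).le)))]
  congr 1
  field_simp

/-- the operator norm of the `m`-linear Hilbert operator on the
Heisenberg group equals `Ω_Q^m (∏ Γ(1-α_i/Q)) Γ(α/Q) / Γ(m)`. -/
theorem statement16 (n : ℕ) (hn : 1 ≤ n) (m : ℕ) (hm : 1 ≤ m)
    (Q : ℝ) (hQ : Q = 2*n+2)
    (α : Fin m → ℝ) (hα : ∀ i, 0 < α i ∧ α i < Q) :
    IsLeast {C : ℝ≥0∞ | ∀ f : Fin m → (Fin (2*n+1) → ℝ) → ℝ,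
        (∀ i, Measurable (f i)) → (∀ i, ∀ y, 0 ≤ f i y) →
        (∀ i, wnorm n (α i) (f i) < ⊤) →
        wnorm n (∑ i, α i)
            (fun x => ∫ y : Fin m → Fin (2*n+1) → ℝ,
              (∏ i, f i (y i)) / (hnorm n x ^ Q + ∑ i, hnorm n (y i) ^ Q) ^ m)
          ≤ C * ∏ i, wnorm n (α i) (f i)}
      (ENNReal.ofReal (ΩQ n ^ m * (∏ i, Real.Gamma (1 - α i / Q)) *
        Real.Gamma ((∑ i, α i) / Q) / Real.Gamma m)) := by
  have hQ0 : 0 < Q := by rw [hQ]; positivity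
  have hm0 : (0:ℝ) < m := by exact_mod_cast hm
  have hΩ : 0 ≤ ΩQ n := ENNReal.toReal_nonneg
  have hmeas := hnorm_meas n
  have hsum : 0 < ∑ i, α i :=
    Finset.sum_pos (fun i _ => (hα i).1) ⟨⟨0, hm⟩, Finset.mem_univ _⟩
  set C₀ : ℝ := ΩQ n ^ m * (∏ i, Real.Gamma (1 - α i / Q)) *
        Real.Gamma ((∑ i, α i) / Q) / Real.Gamma m with hC
  have hC0 : 0 ≤ C₀ := by
    have h1 : 0 ≤ ∏ i, Real.Gamma (1 - α i / Q) := Finset.prod_nonneg fun i _ =>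
      (Real.Gamma_pos_of_pos (by rw [sub_pos, div_lt_one hQ0]; exact (hα i).2)).le
    have h2 := Real.Gamma_pos_of_pos hm0
    have h3 : 0 < Real.Gamma ((∑ i, α i) / Q) := Real.Gamma_pos_of_pos (by positivity)
    positivity
  have hden : ∀ (x : Fin (2*n+1) → ℝ) (y : Fin m → Fin (2*n+1) → ℝ),
      0 ≤ (hnorm n x ^ Q + ∑ i, hnorm n (y i) ^ Q) ^ m := fun x y =>
    pow_nonneg (add_nonneg (Real.rpow_nonneg (hnorm_nonneg n _) _)
      (Finset.sum_nonneg fun i _ => Real.rpow_nonneg (hnorm_nonneg n _) _)) _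
  have hkey : ∀ x : Fin (2*n+1) → ℝ, 0 < hnorm n x →
      ∫⁻ y : Fin m → Fin (2*n+1) → ℝ, ENNReal.ofReal ((∏ i, hnorm n (y i) ^ (-α i))
        / (hnorm n x ^ Q + ∑ i, hnorm n (y i) ^ Q) ^ m)
        = ENNReal.ofReal (C₀ * (hnorm n x ^ (∑ i, α i))⁻¹) := by
    intro x hx
    rw [key_int n m hm Q hQ α hα (Real.rpow_pos_of_pos hx Q), ← Real.rpow_mul hx.le,
      ← Real.rpow_neg hx.le]
    congr 3
    field_simp
  constructor
  · intro f hfm hf0 hfin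
    set M : Fin m → ℝ := fun i => (wnorm n (α i) (f i)).toReal with hM
    have hM0 : ∀ i, 0 ≤ M i := fun i => ENNReal.toReal_nonneg
    have hbound : ∀ i, ∀ᵐ y : Fin (2*n+1) → ℝ, f i y ≤ M i * hnorm n y ^ (-α i) := by
      intro i
      filter_upwards [hnorm_ae_pos n,
        ENNReal.ae_le_essSup (fun x => ENNReal.ofReal (hnorm n x ^ α i * |f i x|))] with y hy hle
      have h1 : hnorm n y ^ α i * |f i y| ≤ M i :=
        (ENNReal.ofReal_le_iff_le_toReal (hfin i).ne).mp hle
      rw [abs_of_nonneg (hf0 i y)] at h1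
      have h2 := Real.rpow_pos_of_pos hy (α i)
      rw [Real.rpow_neg hy.le, ← div_eq_mul_inv, le_div_iff₀ h2]
      linarith
    have hbound2 : ∀ᵐ y : Fin m → Fin (2*n+1) → ℝ, ∀ i,
        f i (y i) ≤ M i * hnorm n (y i) ^ (-α i) := by
      rw [ae_all_iff]
      intro i
      exact (Measure.quasiMeasurePreserving_eval
        (μ := fun _ : Fin m => (volume : Measure (Fin (2*n+1) → ℝ))) i).ae (hbound i)
    have hprod : ENNReal.ofReal (∏ i, M i) = ∏ i, wnorm n (α i) (f i) := by
      rw [ENNReal.ofReal_prod_of_nonneg fun i _ => hM0 i]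
      exact Finset.prod_congr rfl fun i _ => ENNReal.ofReal_toReal (hfin i).ne
    have hMp : 0 ≤ ∏ i, M i := Finset.prod_nonneg fun i _ => hM0 i
    unfold wnorm at hprod ⊢
    refine essSup_le_of_ae_le _ ?_
    filter_upwards [hnorm_ae_pos n] with x hx
    have hxp := Real.rpow_pos_of_pos hx (∑ i, α i)
    rw [← hprod, ENNReal.ofReal_mul hxp.le, ← Real.enorm_eq_ofReal_abs]
    have hI : ‖∫ y : Fin m → Fin (2*n+1) → ℝ,
        (∏ i, f i (y i)) / (hnorm n x ^ Q + ∑ i, hnorm n (y i) ^ Q) ^ m‖ₑ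
        ≤ ENNReal.ofReal (∏ i, M i) * ENNReal.ofReal (C₀ * (hnorm n x ^ (∑ i, α i))⁻¹) := by
      refine (enorm_integral_le_lintegral_enorm _).trans ?_
      rw [← hkey x hx, ← lintegral_const_mul' _ _ ENNReal.ofReal_ne_top]
      refine lintegral_mono_ae ?_
      filter_upwards [hbound2] with y hy
      rw [← ENNReal.ofReal_mul hMp, Real.enorm_eq_ofReal_abs, abs_of_nonneg
        (div_nonneg (Finset.prod_nonneg fun i _ => hf0 i _) (hden x y)), ← mul_div_assoc,
        ← Finset.prod_mul_distrib]
      refine ENNReal.ofReal_le_ofReal (div_le_div_of_nonneg_right ?_ (hden x y))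
      exact Finset.prod_le_prod (fun i _ => hf0 i _) (fun i _ => hy i)
    refine (mul_le_mul_right hI _).trans (le_of_eq ?_)
    rw [← ENNReal.ofReal_mul hMp, ← ENNReal.ofReal_mul hxp.le, ← ENNReal.ofReal_mul hC0]
    congr 1
    field_simp
  · intro C hCm
    have hw : ∀ i, wnorm n (α i) (fun y => hnorm n y ^ (-α i)) ≤ 1 := by
      intro i
      refine essSup_le_of_ae_le _ ?_
      filter_upwards [hnorm_ae_pos n] with x hx
      rw [abs_of_nonneg (Real.rpow_nonneg hx.le _), ← Real.rpow_add hx]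
      simp
    have h := hCm (fun i y => hnorm n y ^ (-α i)) (fun i => hmeas.pow_const _)
      (fun i y => Real.rpow_nonneg (hnorm_nonneg n y) _)
      (fun i => (hw i).trans_lt ENNReal.one_lt_top)
    have h2 : C * ∏ i, wnorm n (α i) (fun y => hnorm n y ^ (-α i)) ≤ C := by
      refine (mul_le_mul_right (Finset.prod_le_one' fun i _ => hw i) C).trans ?_
      simp
    refine le_trans (le_of_eq ?_) (h.trans h2)
    unfold wnorm
    have hne : (volume : Measure (Fin (2*n+1) → ℝ)) ≠ 0 := NeZero.ne _
    rw [← essSup_const (ENNReal.ofReal C₀) hne]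
    refine essSup_congr_ae ?_
    filter_upwards [hnorm_ae_pos n] with x hx
    have hxp := Real.rpow_pos_of_pos hx (∑ i, α i)
    have hc : ∀ i : Fin m, Measurable (fun y : Fin m → Fin (2*n+1) → ℝ => hnorm n (y i)) :=
      fun i => hmeas.comp (measurable_pi_apply i)
    have hFm : Measurable (fun y : Fin m → Fin (2*n+1) → ℝ => (∏ i, hnorm n (y i) ^ (-α i))
        / (hnorm n x ^ Q + ∑ i, hnorm n (y i) ^ Q) ^ m) :=
      (Finset.measurable_prod _ fun i _ => (hc i).pow_const _).div
        (((Finset.measurable_sum _ fun i _ => (hc i).pow_const _).const_add _).pow_const _)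
    rw [integral_eq_lintegral_of_nonneg_ae (Filter.Eventually.of_forall fun y =>
        div_nonneg (Finset.prod_nonneg fun i _ => Real.rpow_nonneg (hnorm_nonneg n _) _)
          (hden x y)) hFm.aestronglyMeasurable, hkey x hx,
      ENNReal.toReal_ofReal (by positivity), abs_of_nonneg (by positivity)]
    congr 1
    field_simp
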